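/- Let K be a field, E ∈ K^{m×σ} with m, σ ≥ 1, J ∈ K^{σ×σ}, s ∈ ℤ^m, and let P be an interpolation basis for (E,J) in s-Popov form with column degree δ = (δ_1,…,δ_m). Set d = ⌈σ/m⌉, and for 1 ≤ i ≤ m write α_i = ⌊δ_i/d⌋ + 1 and β_i = δ_i − (α_i − 1)d, so that δ_i = (α_i − 1)d + β_i with α_i ≥ 1 and 0 ≤ β_i < d. Let m̄ = α_1 + ⋯ + α_m, define δ̄ ∈ ℕ^{m̄} as the concatenation, for i = 1,…,m, of (α_i − 1) copies of d followed by β_i, and define the expansion-compression matrix ℰ ∈ K[X]^{m̄×m} whose column i has entries 1, X^d, …, X^{(α_i−1)d} in rows α_1+⋯+α_{i−1}+1 through α_1+⋯+α_i and zeros elsewhere. Let s^d = −δ̄ ∈ ℤ^{m̄}, and let R ∈ K[X]^{m̄×m̄} be any s^d-reduced interpolation basis for (ℰ·E, J). Then lm_{s^d}(R) is invertible, and P equals the submatrix of lm_{s^d}(R)^{−1}·R·ℰ formed by its rows with indices α_1 + ⋯ + α_i for i = 1,…,m. -/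

import Mathlib

open Polynomial Matrix

/-- Degree of a polynomial as an element of `WithBot ℤ`, with `degZ 0 = ⊥`. -/
noncomputable def degZ {K : Type*} [Field K] (p : Polynomial K) : WithBot ℤ :=
  p.degree.map (fun n : ℕ => (n : ℤ))

/-- The `s`-degree of a row vector `p`: `max_j (deg p_j + s_j)`. -/
noncomputable def sdeg {K : Type*} [Field K] {ι : Type*} [Fintype ι]
    (s : ι → ℤ) (p : ι → Polynomial K) : WithBot ℤ :=
  Finset.univ.sup fun j => degZ (p j) + (s j : WithBot ℤ)

/-- `j` is the `s`-pivot index of the row `p`: the largest index at which the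
`s`-degree of `p` is attained. -/
def IsPivotIndex {K : Type*} [Field K] {ι : Type*} [Fintype ι] [LinearOrder ι]
    (s : ι → ℤ) (p : ι → Polynomial K) (j : ι) : Prop :=
  degZ (p j) + (s j : WithBot ℤ) = sdeg s p ∧
    ∀ k, j < k → degZ (p k) + (s k : WithBot ℤ) ≠ sdeg s p

/-- `P` is in `s`-Popov form: it is nonsingular, the `s`-pivot entries are monic and
on the diagonal, and in each column the nonpivot entries have degree less than
the pivot entry. -/
def IsPopov {K : Type*} [Field K] {m : ℕ} (s : Fin m → ℤ)
    (P : Matrix (Fin m) (Fin m) (Polynomial K)) : Prop :=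
  P.det ≠ 0 ∧ (∀ i, IsPivotIndex s (P i) i) ∧ (∀ i, (P i i).Monic) ∧
    ∀ i j, i ≠ j → (P i j).degree < (P j j).degree

/-- `p` is an interpolant for `(E, J)`: `∑ i, (row i of E) ⋅ (p i)(J) = 0`. -/
def IsInterpolant {K : Type*} [Field K] {ι n : Type*} [Fintype ι] [Fintype n] [DecidableEq n]
    (E : Matrix ι n K) (J : Matrix n n K) (p : ι → Polynomial K) : Prop :=
  ∑ i, Matrix.vecMul (E i) (Polynomial.aeval J (p i)) = 0

/-- `P` is an interpolation basis for `(E, J)`: its rows form a basis of the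
`K[X]`-module of interpolants for `(E, J)`. -/
def IsInterpolationBasis {K : Type*} [Field K] {ι n : Type*} [Fintype ι] [Fintype n]
    [DecidableEq n] (E : Matrix ι n K) (J : Matrix n n K)
    (P : Matrix ι ι (Polynomial K)) : Prop :=
  LinearIndependent (Polynomial K) (fun i => P i) ∧
    (Submodule.span (Polynomial K) (Set.range fun i => P i) : Set (ι → Polynomial K))
      = {p | IsInterpolant E J p}

/-- The product `Q ⋅ E`: the matrix over `K` whose `i`-th row is `∑ j, (E j) ⋅ (Q i j)(J)`. -/
noncomputable def polMulMat {K : Type*} [Field K] {κ ι n : Type*} [Fintype κ] [Fintype ι]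
    [Fintype n] [DecidableEq n]
    (Q : Matrix κ ι (Polynomial K)) (E : Matrix ι n K) (J : Matrix n n K) : Matrix κ n K :=
  fun i => ∑ j, Matrix.vecMul (E j) (Polynomial.aeval J (Q i j))

/-- The `s`-leading matrix of `R`: if row `i` has `s`-degree `d`, its `(i,j)` entry is
the coefficient of degree `d - s j` in `R i j` (and `0` if row `i` is zero). -/
noncomputable def leadingMatrix {K : Type*} [Field K] {ι : Type*} [Fintype ι]
    (s : ι → ℤ) (R : Matrix ι ι (Polynomial K)) : Matrix ι ι K := fun i j =>
  WithBot.recBotCoe 0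
    (fun d => if 0 ≤ d - s j then (R i j).coeff (d - s j).toNat else 0)
    (sdeg s (R i))

section ShiftedDegree

variable {K : Type*} [Field K] {ι : Type*} [Fintype ι]

theorem degZ_add_le_iff (p : K[X]) (s a : ℤ) :
    degZ p + (s : WithBot ℤ) ≤ (a : WithBot ℤ) ↔ ∀ n : ℕ, p.coeff n ≠ 0 → (n : ℤ) + s ≤ a := by
  by_cases hp : p = 0
  · simp [hp, degZ]
  · have h : degZ p = ((p.natDegree : ℤ) : WithBot ℤ) := by
      rw [degZ, degree_eq_natDegree hp]
      rfl
    rw [h, ← WithBot.coe_add, WithBot.coe_le_coe]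
    constructor
    · intro h n hn
      have := le_natDegree_of_ne_zero hn
      omega
    · intro h
      exact h _ (by simpa using hp)

theorem sdeg_le_iff (s : ι → ℤ) (p : ι → K[X]) (a : ℤ) :
    sdeg s p ≤ (a : WithBot ℤ) ↔ ∀ q, ∀ n : ℕ, (p q).coeff n ≠ 0 → (n : ℤ) + s q ≤ a := by
  simp [sdeg, Finset.sup_le_iff, degZ_add_le_iff]

theorem degree_lt_of_natDegree_le_of_coeff_eq_zero {p : K[X]} {n : ℕ} (h : p.natDegree ≤ n)
    (h0 : p.coeff n = 0) : p.degree < n := by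
  rw [degree_lt_iff_coeff_zero]
  intro k hk
  rcases hk.eq_or_lt with rfl | hk
  · exact h0
  · exact coeff_eq_zero_of_natDegree_lt (by omega)

/-- The predictable degree property: in a combination of the rows of a reduced matrix the
leading terms do not cancel. -/
theorem natDegree_add_eq_zero_of_reduced [DecidableEq ι] (D r : ι → ℕ) (R : Matrix ι ι K[X])
    (hdeg : ∀ i q, (R i q).natDegree ≤ r i + D q)
    (hdet : (Matrix.of fun i q => (R i q).coeff (r i + D q)).det ≠ 0)
    (c : ι → K[X]) (hc : ∀ q, (∑ i, c i * R i q).natDegree ≤ D q) (i : ι) (hi : c i ≠ 0) :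
    (c i).natDegree + r i = 0 := by
  classical
  obtain ⟨i₀, h₀, hmax⟩ := Finset.exists_max_image (Finset.univ.filter fun i => c i ≠ 0)
    (fun i => (c i).natDegree + r i) ⟨i, by simpa using hi⟩
  simp only [Finset.mem_filter, Finset.mem_univ, true_and] at h₀ hmax
  set N := (c i₀).natDegree + r i₀ with hN
  by_contra hne
  have hpos : 0 < N := by
    have := hmax i hi
    omega
  have hzero : (fun i => if r i ≤ N then (c i).coeff (N - r i) else 0) = 0 := by
    refine Matrix.eq_zero_of_vecMul_eq_zero hdet ?_
    funext q
    have hcoeff : (∑ i, c i * R i q).coeff (N + D q) = 0 :=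
      coeff_eq_zero_of_natDegree_lt (by have := hc q; omega)
    rw [finsetSum_coeff] at hcoeff
    simp only [Matrix.vecMul, dotProduct, Matrix.of_apply, Pi.zero_apply]
    refine Eq.trans ?_ hcoeff
    refine Finset.sum_congr rfl fun k _ => ?_
    by_cases hk : c k = 0
    · simp [hk]
    · have hk' := hmax k hk
      rw [if_pos (by omega), show N + D q = (N - r k) + (r k + D q) by omega,
        coeff_mul_add_eq_of_natDegree_le (by omega) (hdeg k q)]
  have := congrFun hzero i₀
  simp only [Pi.zero_apply] at this
  rw [if_pos (by omega), show N - r i₀ = (c i₀).natDegree by omega] at this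
  exact h₀ (by simpa using this)

theorem mem_span_rows_iff (R : Matrix ι ι K[X]) (p : ι → K[X]) :
    p ∈ Submodule.span K[X] (Set.range fun i => R i) ↔
      ∃ c : ι → K[X], ∀ q, ∑ i, c i * R i q = p q := by
  rw [Submodule.mem_span_range_iff_exists_fun]
  simp [funext_iff, Finset.sum_apply]

/-- If a module contains no nonzero vector of negative `(-D)`-degree, but vectors of `(-D)`-degree
at most zero with arbitrary leading coefficients, then all rows of a `(-D)`-reduced basis
have `(-D)`-degree zero. -/
theorem natDegree_le_and_leadingMatrix_eq [DecidableEq ι] (D : ι → ℕ) (s : ι → ℤ)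
    (hs : ∀ q, s q = -(D q : ℤ)) (R : Matrix ι ι K[X]) (hred : (leadingMatrix s R).det ≠ 0)
    (hneg : ∀ p ∈ Submodule.span K[X] (Set.range fun i => R i),
      (∀ q, (p q).degree < D q) → p = 0)
    (hlead : ∀ q, ∃ p ∈ Submodule.span K[X] (Set.range fun i => R i),
      (∀ q', (p q').natDegree ≤ D q') ∧ ∀ q', (p q').coeff (D q') = if q = q' then 1 else 0) :
    (∀ i q, (R i q).natDegree ≤ D q) ∧
      leadingMatrix s R = Matrix.of fun i q => (R i q).coeff (D q) := by
  have hr : ∀ i, ∃ r : ℕ, sdeg s (R i) = ((r : ℤ) : WithBot ℤ) := by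
    intro i
    by_cases hlt : sdeg s (R i) ≤ ((-1 : ℤ) : WithBot ℤ)
    · exfalso
      have h0 : R i = 0 := by
        refine hneg _ (Submodule.subset_span ⟨i, rfl⟩) fun q => ?_
        rw [degree_lt_iff_coeff_zero]
        intro n hn
        by_contra hne
        have := (sdeg_le_iff _ _ _).1 hlt q n hne
        rw [hs] at this
        omega
      refine hred (Matrix.det_eq_zero_of_row_eq_zero i fun q => ?_)
      unfold leadingMatrix
      cases sdeg s (R i) with
      | bot => rfl
      | coe a => simp [h0]
    · cases h : sdeg s (R i) with
      | bot => simp [h] at hlt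
      | coe a =>
        rw [h, WithBot.coe_le_coe] at hlt
        exact ⟨a.toNat, by rw [Int.toNat_of_nonneg (by omega)]⟩
  choose r hr using hr
  have hdeg : ∀ i q, (R i q).natDegree ≤ r i + D q := by
    intro i q
    by_cases h0 : R i q = 0
    · simp [h0]
    · have := (sdeg_le_iff _ _ _).1 (hr i).le q (R i q).natDegree (by simpa using h0)
      rw [hs] at this
      omega
  have hlm : leadingMatrix s R = Matrix.of fun i q => (R i q).coeff (r i + D q) := by
    ext i q
    unfold leadingMatrix
    rw [hr, hs]
    simp only [WithBot.recBotCoe_coe, Matrix.of_apply]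
    rw [if_pos (by omega)]
    congr 1
    omega
  have hdet := hlm ▸ hred
  have hr0 : ∀ i, r i = 0 := by
    choose p hp hpdeg hpcoeff using hlead
    choose c hc using fun q => (mem_span_rows_iff R (p q)).1 (hp q)
    have hcr : ∀ q i, c q i ≠ 0 → (c q i).natDegree + r i = 0 := fun q i hi =>
      natDegree_add_eq_zero_of_reduced D r R hdeg hdet (c q)
        (fun q' => by rw [hc]; exact hpdeg q q') i hi
    have hmul : (Matrix.of fun q i => (c q i).coeff 0) * leadingMatrix s R = 1 := by
      ext q q'
      rw [hlm, Matrix.mul_apply, Matrix.one_apply, ← hpcoeff, ← hc, finsetSum_coeff]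
      refine Finset.sum_congr rfl fun i _ => ?_
      by_cases h0 : c q i = 0
      · simp [h0]
      · have h := hcr q i h0
        rw [eq_C_of_natDegree_eq_zero (show (c q i).natDegree = 0 by omega)]
        simp [show r i = 0 by omega]
    intro i
    by_contra hi
    have hmul' := mul_eq_one_comm.1 hmul
    have h1 := congrFun (congrFun hmul' i) i
    rw [Matrix.mul_apply, Matrix.one_apply_eq, Finset.sum_eq_zero] at h1
    · exact zero_ne_one h1
    · intro q _
      have : c q i = 0 := by
        by_contra h0
        have := hcr q i h0
        omega
      simp [this]
  refine ⟨fun i q => by simpa [hr0] using hdeg i q, ?_⟩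
  rw [hlm]
  simp [hr0]

end ShiftedDegree

section Expansion

variable {K : Type*} [Field K]

theorem eq_zero_of_sum_mul_X_pow_eq_zero {n d : ℕ} (g : Fin n → K[X])
    (hg : ∀ k, (g k).degree < d) (h : ∑ k, g k * X ^ ((k : ℕ) * d) = 0) (k : Fin n) :
    g k = 0 := by
  ext t
  rw [coeff_zero]
  by_cases ht : d ≤ t
  · exact (degree_lt_iff_coeff_zero _ _).1 (hg k) t ht
  · have hc := congrArg (fun p => p.coeff (t + k * d)) h
    simp only [finsetSum_coeff, coeff_zero] at hc
    rw [Finset.sum_eq_single k, coeff_mul_X_pow] at hc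
    · exact hc
    · intro l _ hl
      rw [coeff_mul_X_pow']
      split_ifs with hle
      · refine (degree_lt_iff_coeff_zero _ _).1 (hg l) _ ?_
        have hlk : (l : ℕ) < k := by
          by_contra hkl
          have : (k : ℕ) + 1 ≤ l := by
            have : (l : ℕ) ≠ k := fun e => hl (Fin.ext e)
            omega
          have := Nat.mul_le_mul_right d this
          rw [add_mul] at this
          omega
        have := Nat.mul_le_mul_right d (show (l : ℕ) + 1 ≤ k from hlk)
        rw [add_mul] at this
        omega
      · rfl
    · simp

theorem exists_expansion (d a : ℕ) (f : K[X]) :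
    ∃ g : Fin (a + 1) → K[X], ∑ k, g k * X ^ ((k : ℕ) * d) = f ∧
      (∀ k : Fin (a + 1), (k : ℕ) ≠ a → (g k).degree < d) ∧
      ∀ t, (g (Fin.last a)).coeff t = f.coeff (t + a * d) := by
  induction a generalizing f with
  | zero => exact ⟨fun _ => f, by simp, fun k hk => absurd (Fin.val_eq_zero k) hk, by simp⟩
  | succ a ih =>
    obtain ⟨g, hsum, hdeg, hlast⟩ := ih (f /ₘ X ^ d)
    have hmod : (f %ₘ X ^ d).degree < d := by
      simpa using degree_modByMonic_lt f (monic_X_pow (R := K) d)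
    have hf : f %ₘ X ^ d + (f /ₘ X ^ d) * X ^ d = f := by
      rw [mul_comm]
      exact modByMonic_add_div f (X ^ d)
    refine ⟨Fin.cons (f %ₘ X ^ d) g, ?_, ?_, ?_⟩
    · rw [Fin.sum_univ_succ]
      conv_rhs => rw [← hf, ← hsum, Finset.sum_mul]
      simp [add_mul, pow_add, mul_assoc]
    · intro k
      refine Fin.cases ?_ (fun k => ?_) k
      · intro _
        simpa using hmod
      · intro hk
        simpa using hdeg k (by simpa using hk)
    · intro t
      rw [← Fin.succ_last, Fin.cons_succ, hlast]
      conv_rhs => rw [← hf]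
      rw [coeff_add, (degree_lt_iff_coeff_zero _ _).1 hmod _ (by rw [add_mul]; omega),
        show t + (a + 1) * d = (t + a * d) + d by ring, coeff_mul_X_pow, zero_add]

end Expansion

section Interpolants

variable {K : Type*} [Field K]

theorem isInterpolant_polMulMat_iff {κ ι n : Type*} [Fintype κ] [Fintype ι] [Fintype n]
    [DecidableEq n] (Q : Matrix κ ι K[X]) (E : Matrix ι n K) (J : Matrix n n K) (p : κ → K[X]) :
    IsInterpolant (polMulMat Q E J) J p ↔ IsInterpolant E J (p ᵥ* Q) := by
  unfold IsInterpolant polMulMat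
  simp only [Matrix.vecMul, dotProduct, map_sum, map_mul]
  have : (∑ q, Matrix.vecMul (∑ j, Matrix.vecMul (E j) (aeval J (Q q j))) (aeval J (p q))) =
      ∑ j, Matrix.vecMul (E j) (∑ q, aeval J (p q) * aeval J (Q q j)) := by
    simp only [Matrix.sum_vecMul, Matrix.vecMul_sum, Matrix.vecMul_vecMul]
    rw [Finset.sum_comm]
    simp only [← map_mul, mul_comm]
  constructor
  · intro h
    exact this.symm.trans h
  · intro h
    exact this.trans h

theorem IsInterpolationBasis.mem_span_iff {ι n : Type*} [Fintype ι] [Fintype n] [DecidableEq n]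
    {E : Matrix ι n K} {J : Matrix n n K} {P : Matrix ι ι K[X]} (h : IsInterpolationBasis E J P)
    (p : ι → K[X]) :
    p ∈ Submodule.span K[X] (Set.range fun i => P i) ↔ IsInterpolant E J p := by
  rw [← SetLike.mem_coe, h.2]
  rfl

/-- An element of the row space of a Popov matrix whose entries have smaller degree than
the diagonal entries vanishes. -/
theorem IsPopov.eq_zero_of_degree_lt {m : ℕ} {s : Fin m → ℤ} {P : Matrix (Fin m) (Fin m) K[X]}
    (hP : IsPopov s P) {p : Fin m → K[X]}
    (hp : p ∈ Submodule.span K[X] (Set.range fun i => P i))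
    (hdeg : ∀ j, (p j).degree < (P j j).natDegree) : p = 0 := by
  obtain ⟨c, hc⟩ := (mem_span_rows_iff P p).1 hp
  have hle : ∀ i j, (P i j).natDegree ≤ (P j j).natDegree := by
    intro i j
    by_cases hij : i = j
    · rw [hij]
    · exact natDegree_le_natDegree (hP.2.2.2 i j hij).le
  have hone : ∀ i j, (P i j).coeff (P j j).natDegree = if i = j then 1 else 0 := by
    intro i j
    split_ifs with hij
    · rw [hij]
      exact hP.2.2.1 j
    · refine coeff_eq_zero_of_degree_lt ?_
      rw [← degree_eq_natDegree (hP.2.2.1 j).ne_zero]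
      exact hP.2.2.2 i j hij
  have hc0 : ∀ i, c i = 0 := by
    intro i
    have hconst : ∀ k, (c k).natDegree = 0 := by
      intro k
      by_cases hk : c k = 0
      · simp [hk]
      · refine natDegree_add_eq_zero_of_reduced (fun j => (P j j).natDegree) 0 P
          (by simpa using hle) ?_ c (fun q => ?_) k hk
        · have : (Matrix.of fun i q => (P i q).coeff ((0 : Fin m → ℕ) i + (P q q).natDegree))
              = (1 : Matrix (Fin m) (Fin m) K) := by
            ext i q
            simp [hone, Matrix.one_apply]
          rw [this, Matrix.det_one]
          exact one_ne_zero
        · rw [hc]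
          exact natDegree_le_of_degree_le (hdeg q).le
    have h := coeff_eq_zero_of_degree_lt (hdeg i)
    rw [← hc i, finsetSum_coeff, Finset.sum_eq_single i] at h
    · rw [eq_C_of_natDegree_eq_zero (hconst i), coeff_C_mul, hone] at h
      rw [eq_C_of_natDegree_eq_zero (hconst i)]
      simpa using h
    · intro k _ hk
      rw [eq_C_of_natDegree_eq_zero (hconst k), coeff_C_mul, hone, if_neg hk, mul_zero]
    · simp
  funext j
  rw [← hc]
  simp [hc0]

end Interpolants

/-- recovering the `s`-Popov interpolation basis `P` with known column
degree `δ` from any `(-δ̄)`-reduced interpolation basis `R` for the partially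
linearized problem `(ℰ⋅E, J)`, where `d = ⌈σ/m⌉`, block `i` has `α i = ⌊δ i / d⌋ + 1`
rows indexed by `Fin (δ i / d + 1)`, `δ̄ ⟨i,k⟩ = d` except `δ̄ ⟨i, α i - 1⟩ = δ i % d`,
and `ℰ` has column `i` equal to `1, X^d, …, X^((α i - 1)d)` in block `i`.
Then `lm_{-δ̄}(R)` is invertible and `P` is the submatrix of `lm_{-δ̄}(R)⁻¹ ⋅ R ⋅ ℰ`
given by the last row of each block. -/
theorem known_minimal_degree_popov_basis {K : Type*} [Field K] {m σ : ℕ}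
    (hm : 1 ≤ m) (hσ : 1 ≤ σ)
    (E : Matrix (Fin m) (Fin σ) K) (J : Matrix (Fin σ) (Fin σ) K) (s : Fin m → ℤ)
    (P : Matrix (Fin m) (Fin m) (Polynomial K))
    (hbasis : IsInterpolationBasis E J P) (hpopov : IsPopov s P)
    (δ : Fin m → ℕ) (hδ : ∀ i, (P i i).natDegree = δ i)
    (d : ℕ) (hd : d = (σ + m - 1) / m)
    (Emat : Matrix ((i : Fin m) × Fin (δ i / d + 1)) (Fin m) (Polynomial K))
    (hEmat : ∀ q : (i : Fin m) × Fin (δ i / d + 1), ∀ j : Fin m,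
      Emat q j = if q.1 = j then (Polynomial.X : Polynomial K) ^ ((q.2 : ℕ) * d) else 0)
    (sd : ((i : Fin m) × Fin (δ i / d + 1)) → ℤ)
    (hsd : ∀ q : (i : Fin m) × Fin (δ i / d + 1),
      sd q = -(if (q.2 : ℕ) = δ q.1 / d then ((δ q.1 % d : ℕ) : ℤ) else (d : ℤ)))
    (R : Matrix ((i : Fin m) × Fin (δ i / d + 1)) ((i : Fin m) × Fin (δ i / d + 1))
      (Polynomial K))
    (hR : IsInterpolationBasis (polMulMat Emat E J) J R)
    (hred : (leadingMatrix sd R).det ≠ 0) :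
    IsUnit (leadingMatrix sd R) ∧
      ∀ (i : Fin m) (j : Fin m),
        P i j = (((leadingMatrix sd R)⁻¹).map Polynomial.C * R * Emat)
          ⟨i, Fin.last (δ i / d)⟩ j := by
  have hd0 : 0 < d := by
    rw [hd]
    exact Nat.div_pos (by omega) (by omega)
  refine ⟨(Matrix.isUnit_iff_isUnit_det _).2 hred.isUnit, ?_⟩
  set D : ((i : Fin m) × Fin (δ i / d + 1)) → ℕ :=
    fun q => if (q.2 : ℕ) = δ q.1 / d then δ q.1 % d else d with hD
  have hs : ∀ q, sd q = -(D q : ℤ) := by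
    intro q
    rw [hsd, hD]
    push_cast
    rfl
  have hDle : ∀ q, D q ≤ d := by
    intro q
    simp only [hD]
    split_ifs
    · exact (Nat.mod_lt _ hd0).le
    · exact le_rfl
  have hDlast : ∀ i, D ⟨i, Fin.last _⟩ = δ i % d := by
    intro i
    simp [hD]
  have hvec : ∀ (p : ((i : Fin m) × Fin (δ i / d + 1)) → K[X]) (j : Fin m),
      (p ᵥ* Emat) j = ∑ k : Fin (δ j / d + 1), p ⟨j, k⟩ * X ^ ((k : ℕ) * d) := by
    intro p j
    simp only [Matrix.vecMul, dotProduct, hEmat, Fintype.sum_sigma]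
    rw [Finset.sum_eq_single j]
    · simp
    · intro i _ hi
      simp [hi]
    · simp
  have hmem : ∀ p, p ∈ Submodule.span K[X] (Set.range fun i => R i) ↔
      p ᵥ* Emat ∈ Submodule.span K[X] (Set.range fun i => P i) := by
    intro p
    rw [hR.mem_span_iff, hbasis.mem_span_iff, isInterpolant_polMulMat_iff]
  have hneg : ∀ p ∈ Submodule.span K[X] (Set.range fun i => R i),
      (∀ q, (p q).degree < D q) → p = 0 := by
    intro p hp hdeg
    have h0 : p ᵥ* Emat = 0 := by
      refine hpopov.eq_zero_of_degree_lt ((hmem p).1 hp) fun j => ?_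
      rw [hδ, hvec, degree_lt_iff_coeff_zero]
      intro n hn
      rw [finsetSum_coeff]
      refine Finset.sum_eq_zero fun k _ => ?_
      rw [coeff_mul_X_pow']
      split_ifs with hle
      · refine (degree_lt_iff_coeff_zero _ _).1 (hdeg ⟨j, k⟩) _ ?_
        have hmod := Nat.div_add_mod' (δ j) d
        simp only [hD]
        split_ifs with hk
        · rw [hk]
          omega
        · have := Nat.mul_le_mul_right d (show (k : ℕ) + 1 ≤ δ j / d by omega)
          rw [add_mul] at this
          omega
      · rfl
    funext ⟨j, k⟩
    refine eq_zero_of_sum_mul_X_pow_eq_zero (d := d) (fun k => p ⟨j, k⟩) (fun k => ?_) ?_ k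
    · exact (hdeg ⟨j, k⟩).trans_le (by exact_mod_cast hDle _)
    · rw [← hvec, h0]
      rfl
  have hPcoeff : ∀ i j, (P i j).coeff (δ j) = if i = j then 1 else 0 := by
    intro i j
    split_ifs with hij
    · rw [hij, ← hδ]
      exact hpopov.2.2.1 j
    · refine coeff_eq_zero_of_degree_lt ?_
      rw [← hδ, ← degree_eq_natDegree (hpopov.2.2.1 j).ne_zero]
      exact hpopov.2.2.2 i j hij
  have hPdeg : ∀ i j, (P i j).natDegree ≤ δ j := by
    intro i j
    rw [← hδ]
    by_cases hij : i = j
    · rw [hij]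
    · exact natDegree_le_natDegree (hpopov.2.2.2 i j hij).le
  -- The expansion of row `i` of `P` in powers of `X ^ d`.
  have hexp : ∀ i : Fin m, ∃ b : ((i : Fin m) × Fin (δ i / d + 1)) → K[X],
      b ᵥ* Emat = P i ∧ (∀ q, (b q).natDegree ≤ D q) ∧
        ∀ q, (b q).coeff (D q) = if ⟨i, Fin.last _⟩ = q then 1 else 0 := by
    intro i
    choose g hsum hdeg hlast using fun j => exists_expansion d (δ j / d) (P i j)
    refine ⟨fun q => g q.1 q.2, ?_, ?_, ?_⟩
    · funext j
      rw [hvec, hsum]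
    · rintro ⟨j, k⟩
      by_cases hk : (k : ℕ) = δ j / d
      · obtain rfl : k = Fin.last _ := Fin.ext hk
        rw [hDlast, natDegree_le_iff_coeff_eq_zero]
        intro n hn
        rw [hlast]
        refine coeff_eq_zero_of_natDegree_lt ?_
        dsimp only
        have := hPdeg i j
        have := Nat.div_add_mod' (δ j) d
        omega
      · simp only [hD, if_neg hk]
        exact natDegree_le_of_degree_le (hdeg j k hk).le
    · rintro ⟨j, k⟩
      by_cases hk : (k : ℕ) = δ j / d
      · obtain rfl : k = Fin.last _ := Fin.ext hk
        rw [hDlast, hlast, add_comm, Nat.div_add_mod', hPcoeff]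
        by_cases hij : i = j
        · subst hij
          simp
        · simp [hij]
      · simp only [hD, if_neg hk]
        rw [coeff_eq_zero_of_degree_lt (hdeg j k hk), if_neg]
        intro h
        rw [Sigma.mk.injEq] at h
        obtain ⟨rfl, h⟩ := h
        rw [heq_eq_eq] at h
        exact hk (by rw [← h]; rfl)
  choose b hbE hbdeg hbcoeff using hexp
  have hbmem : ∀ i, b i ∈ Submodule.span K[X] (Set.range fun i => R i) := by
    intro i
    rw [hmem, hbE]
    exact Submodule.subset_span ⟨i, rfl⟩
  have hlead : ∀ q, ∃ p ∈ Submodule.span K[X] (Set.range fun i => R i),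
      (∀ q', (p q').natDegree ≤ D q') ∧
        ∀ q', (p q').coeff (D q') = if q = q' then 1 else 0 := by
    rintro ⟨i, k⟩
    by_cases hk : (k : ℕ) = δ i / d
    · obtain rfl : k = Fin.last _ := Fin.ext hk
      exact ⟨b i, hbmem i, hbdeg i, hbcoeff i⟩
    have hklt : (k : ℕ) + 1 < δ i / d + 1 := by
      have := k.2
      omega
    set q₀ : (i : Fin m) × Fin (δ i / d + 1) := ⟨i, k⟩ with hq₀
    set q₁ : (i : Fin m) × Fin (δ i / d + 1) := ⟨i, ⟨k + 1, hklt⟩⟩ with hq₁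
    have hDq₀ : D q₀ = d := by simp only [hD, hq₀, if_neg hk]
    set ε : K[X] := if D q₁ = 0 then 1 else 0 with hε
    have hεdeg : ε.natDegree = 0 := by
      rw [hε]
      split_ifs <;> simp
    refine ⟨Pi.single q₀ (X ^ d) - Pi.single q₁ 1 + ε • b i, ?_, ?_, ?_⟩
    · refine Submodule.add_mem _ ?_ (Submodule.smul_mem _ _ (hbmem i))
      rw [hmem]
      have : (Pi.single q₀ (X ^ d) - Pi.single q₁ 1) ᵥ* Emat = 0 := by
        funext j
        rw [Matrix.sub_vecMul]
        simp only [Matrix.single_vecMul, Pi.sub_apply, Pi.smul_apply, Matrix.row_apply, hEmat,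
          hq₀, hq₁, smul_eq_mul]
        rw [Pi.zero_apply]
        split_ifs
        · ring
        · ring
      rw [this]
      exact Submodule.zero_mem _
    · intro q
      have h1 : (Pi.single (M := fun _ => K[X]) q₀ (X ^ d) q).natDegree ≤ D q := by
        by_cases h : q = q₀
        · subst h
          simp [hDq₀]
        · simp [h]
      have h2 : (Pi.single (M := fun _ => K[X]) q₁ 1 q).natDegree ≤ D q := by
        by_cases h : q = q₁
        · subst h
          simp
        · simp [h]
      have h3 : (ε * b i q).natDegree ≤ D q := by
        have := hbdeg i q
        exact natDegree_mul_le.trans (by omega)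
      exact natDegree_add_le_of_degree_le (natDegree_sub_le_of_le h1 h2 |>.trans (by simp)) h3
    · intro q
      have h1 : (Pi.single (M := fun _ => K[X]) q₀ (X ^ d) q).coeff (D q) =
          if q₀ = q then 1 else 0 := by
        by_cases h : q₀ = q
        · subst h
          simp [hDq₀]
        · simp [h, Ne.symm h]
      have h2 : (Pi.single (M := fun _ => K[X]) q₁ 1 q).coeff (D q) = (ε * b i q).coeff (D q) := by
        by_cases h0 : D q₁ = 0
        · have hlast : q₁ = ⟨i, Fin.last _⟩ := by
            have : (k : ℕ) + 1 = δ i / d := by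
              by_contra hne
              simp only [hD, hq₁, if_neg hne] at h0
              omega
            rw [hq₁]
            congr 1
            exact Fin.ext this
          rw [hε, if_pos h0, one_mul, hbcoeff, ← hlast]
          by_cases h : q₁ = q
          · subst h
            simp [h0]
          · simp [h, Ne.symm h]
        · rw [hε, if_neg h0, zero_mul]
          by_cases h : q₁ = q
          · subst h
            simp [coeff_one, h0]
          · simp [Ne.symm h]
      simp only [Pi.add_apply, Pi.sub_apply, Pi.smul_apply, smul_eq_mul, coeff_add, coeff_sub, h1,
        ← h2, sub_add_cancel]
  obtain ⟨hRdeg, hRlead⟩ := natDegree_le_and_leadingMatrix_eq D sd hs R hred hneg hlead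
  intro i j
  set L := leadingMatrix sd R with hL
  have hrow : (L⁻¹.map C * R) ⟨i, Fin.last _⟩ = b i := by
    rw [← sub_eq_zero]
    refine hneg _ (Submodule.sub_mem _ ?_ (hbmem i)) fun q => ?_
    · rw [mem_span_rows_iff]
      exact ⟨fun q => C (L⁻¹ ⟨i, Fin.last _⟩ q), fun q => rfl⟩
    · refine degree_lt_of_natDegree_le_of_coeff_eq_zero ?_ ?_
      · refine (natDegree_sub_le_of_le (m := D q) ?_ (hbdeg i q)).trans (by simp)
        rw [Matrix.mul_apply]
        exact natDegree_sum_le_of_forall_le _ _ fun k _ =>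
          (natDegree_C_mul_le _ _).trans (hRdeg k q)
      · have hinv := congrFun (congrFun (Matrix.nonsing_inv_mul L hred.isUnit)
          ⟨i, Fin.last _⟩) q
        rw [Matrix.mul_apply, Matrix.one_apply] at hinv
        rw [Pi.sub_apply, coeff_sub, hbcoeff, ← hinv, Matrix.mul_apply, finsetSum_coeff,
          sub_eq_zero]
        refine Finset.sum_congr rfl fun k _ => ?_
        rw [Matrix.map_apply, coeff_C_mul, hRlead]
        rfl
  rw [← hbE i, ← hrow]
  rfl
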